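/- arXiv:2404.05026 — 2 statements merged into one kernel-verified Lean document; each statement's English description precedes it below -/
import Mathlib

section
/- Fix an integer k ≥ 3 and a real δ ∈ (0,1). There exist c > 0 and N such that for all n ≥ N, the number of H ∈ B_n admitting some bipartition [n] = X ∪ Y that violates property (R) — i.e., for which some pairwise disjoint triple (J, X₀, Y₀) with J a (k−2)-element subset of [n], X₀ ⊆ X, Y₀ ⊆ Y and |X₀|, |Y₀| > δn fails one of: (R₁) |e_{H_J}(X₀,Y₀) − (1/2)|X₀||Y₀|| ≤ δ·(1/2)|X₀||Y₀|; (R₂) if J ⊄ X then |e_{H_J}(X₀) − (1/2)C(|X₀|,2)| ≤ δ·(1/2)C(|X₀|,2); (R₃) if J ⊄ Y then |e_{H_J}(Y₀) − (1/2)C(|Y₀|,2)| ≤ δ·(1/2)C(|Y₀|,2) — is at most |B_n| · 2^{−c·n²}. -/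
open Finset

/-- `H` is a `k`-graph on `[n]`: every edge is a `k`-element subset. -/
def IsKGraph (n k : ℕ) (H : Finset (Finset (Fin n))) : Prop :=
  ∀ e ∈ H, e.card = k

/-- `X, Y` is a bipartition of the hypergraph `H` on `[n]`. -/
def IsBipartition (n : ℕ) (H : Finset (Finset (Fin n))) (X Y : Finset (Fin n)) : Prop :=
  Disjoint X Y ∧ X ∪ Y = Finset.univ ∧ ∀ e ∈ H, ¬ e ⊆ X ∧ ¬ e ⊆ Y

/-- `B_n`: the collection of all bipartite `k`-graphs on `[n]`. -/
def Bip (n k : ℕ) : Set (Finset (Finset (Fin n))) :=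
  {H | IsKGraph n k H ∧ ∃ X Y : Finset (Fin n), IsBipartition n H X Y}

/-- `K[X,Y]`: the crossing `k`-sets, i.e. those contained neither in `X` nor in `Y`. -/
def crossing (n k : ℕ) (X Y : Finset (Fin n)) : Finset (Finset (Fin n)) :=
  (Finset.univ.powersetCard k).filter fun e => ¬ e ⊆ X ∧ ¬ e ⊆ Y

/-- joint `H`-degree of `u` and `v`: the number of `(k-1)`-sets `J ⊆ [n] \ {u,v}`
with `{u} ∪ J ∈ H` and `{v} ∪ J ∈ H`. -/
def jointDeg (n k : ℕ) (H : Finset (Finset (Fin n))) (u v : Fin n) : ℕ :=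
  (((Finset.univ \ {u, v}).powersetCard (k - 1)).filter
    fun J => insert u J ∈ H ∧ insert v J ∈ H).card

/-- `deg_H(v, U)`: the number of `(k-1)`-sets `J ⊆ U \ {v}` with `{v} ∪ J ∈ H`. -/
def degIn (n k : ℕ) (H : Finset (Finset (Fin n))) (v : Fin n) (U : Finset (Fin n)) : ℕ :=
  (((U \ {v}).powersetCard (k - 1)).filter fun J => insert v J ∈ H).card

/-- `e_{H_J}(A, B)`: for disjoint `A`, `B`, the number of link-graph edges of `H_J`
with one endpoint in `A` and one in `B`. -/
def linkBetween (n : ℕ) (H : Finset (Finset (Fin n))) (J A B : Finset (Fin n)) : ℕ :=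
  ((A ×ˢ B).filter fun p => p.1 ∉ J ∧ p.2 ∉ J ∧ insert p.1 (insert p.2 J) ∈ H).card

/-- `e_{H_J}(A)`: the number of link-graph edges of `H_J` contained in `A`. -/
def linkWithin (n : ℕ) (H : Finset (Finset (Fin n))) (J A : Finset (Fin n)) : ℕ :=
  ((A.powersetCard 2).filter fun p => Disjoint p J ∧ p ∪ J ∈ H).card

/-- Exponential moment of the deviation of `#(F ∩ T)` over all subsets `F` of `S`. -/
theorem sum_powerset_exp_le {α : Type*} [DecidableEq α] {S T : Finset α} (hT : T ⊆ S) (t : ℝ) :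
    ∑ F ∈ S.powerset, Real.exp (t * (2 * (#(F ∩ T) : ℝ) - #T)) ≤
      2 ^ #S * Real.exp (t ^ 2 * #T / 2) := by
  have hsum : ∑ F ∈ S.powerset, Real.exp (t * (2 * (#(F ∩ T) : ℝ) - #T)) =
      ∏ i ∈ S, ((if i ∈ T then Real.exp t else 1) + if i ∈ T then Real.exp (-t) else 1) := by
    rw [Finset.prod_add]
    refine Finset.sum_congr rfl fun F hF => ?_
    rw [Finset.mem_powerset] at hF
    have hsdiff : (S \ F) ∩ T = T \ (F ∩ T) := by
      ext x
      have := @hT x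
      simp only [Finset.mem_inter, Finset.mem_sdiff]
      tauto
    rw [Finset.prod_ite_mem, Finset.prod_ite_mem, Finset.prod_const, Finset.prod_const, hsdiff,
      ← Real.exp_nat_mul, ← Real.exp_nat_mul, ← Real.exp_add,
      Finset.cast_card_sdiff Finset.inter_subset_right]
    congr 1
    ring
  have hfactor : ∀ i ∈ S,
      ((if i ∈ T then Real.exp t else 1) + if i ∈ T then Real.exp (-t) else 1) ≤
        2 * if i ∈ T then Real.exp (t ^ 2 / 2) else 1 := by
    intro i _
    split_ifs
    · have := Real.cosh_le_exp_half_sq t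
      rw [Real.cosh_eq] at this
      linarith
    · norm_num
  rw [hsum]
  refine (Finset.prod_le_prod (fun i _ => by positivity) hfactor).trans_eq ?_
  rw [Finset.prod_mul_distrib, Finset.prod_const, Finset.prod_ite_mem,
    Finset.inter_eq_right.mpr hT, Finset.prod_const, ← Real.exp_nat_mul]
  congr 2
  ring

/-- Chernoff bound for the intersection of a uniformly random subset of `S` with `T ⊆ S`. -/
theorem card_powerset_deviation_le {α : Type*} [DecidableEq α] {S T : Finset α} (hT : T ⊆ S)
    {δ : ℝ} (hδ : 0 ≤ δ) :
    (#(S.powerset.filter fun F => δ * #T < |2 * (#(F ∩ T) : ℝ) - #T|) : ℝ) ≤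
      2 ^ #S * (2 * Real.exp (-(δ ^ 2 * #T / 2))) := by
  have hmarkov : (#(S.powerset.filter fun F => δ * #T < |2 * (#(F ∩ T) : ℝ) - #T|) : ℝ) ≤
      ∑ F ∈ S.powerset, Real.exp (-(δ ^ 2 * #T)) *
        (Real.exp (δ * (2 * (#(F ∩ T) : ℝ) - #T)) +
          Real.exp (-δ * (2 * (#(F ∩ T) : ℝ) - #T))) := by
    rw [← nsmul_one, ← Finset.sum_const]
    refine (Finset.sum_le_sum fun F hF => ?_).trans
      (Finset.sum_le_sum_of_subset_of_nonneg (Finset.filter_subset _ _)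
        fun F _ _ => by positivity)
    have hdev := (Finset.mem_filter.mp hF).2
    rw [mul_add, ← Real.exp_add, ← Real.exp_add]
    rcases lt_abs.mp hdev with h | h
    · have := Real.one_le_exp (x := -(δ ^ 2 * #T) + δ * (2 * (#(F ∩ T) : ℝ) - #T))
        (by nlinarith)
      linarith [Real.exp_nonneg (-(δ ^ 2 * #T) + -δ * (2 * (#(F ∩ T) : ℝ) - #T))]
    · have := Real.one_le_exp (x := -(δ ^ 2 * #T) + -δ * (2 * (#(F ∩ T) : ℝ) - #T))
        (by nlinarith)
      linarith [Real.exp_nonneg (-(δ ^ 2 * #T) + δ * (2 * (#(F ∩ T) : ℝ) - #T))]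
  refine hmarkov.trans ?_
  rw [← Finset.mul_sum, Finset.sum_add_distrib]
  have hpos := sum_powerset_exp_le hT δ
  have hneg := sum_powerset_exp_le hT (-δ)
  rw [neg_sq] at hneg
  calc _ ≤ Real.exp (-(δ ^ 2 * #T)) * (2 ^ #S * Real.exp (δ ^ 2 * #T / 2) +
        2 ^ #S * Real.exp (δ ^ 2 * #T / 2)) := by gcongr
    _ = 2 ^ #S * (2 * (Real.exp (-(δ ^ 2 * #T)) * Real.exp (δ ^ 2 * #T / 2))) := by ring
    _ = _ := by
      rw [← Real.exp_add]
      ring_nf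

/-- Union bound over a finite family of pairs `T i ⊆ S i`. -/
theorem ncard_exists_deviation_le {α ι : Type*} [DecidableEq α] [Fintype ι]
    (S T : ι → Finset α) {δ m M : ℝ} (hδ : 0 ≤ δ) (hS : ∀ i, (2 : ℝ) ^ #(S i) ≤ M) :
    ({F : Finset α | ∃ i, F ⊆ S i ∧ T i ⊆ S i ∧ m ≤ #(T i) ∧
        δ * #(T i) < |2 * (#(F ∩ T i) : ℝ) - #(T i)|}.ncard : ℝ) ≤
      Fintype.card ι * (M * (2 * Real.exp (-(δ ^ 2 * m / 2)))) := by
  classical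
  set G : ι → Finset (Finset α) := fun i =>
    (S i).powerset.filter fun F => T i ⊆ S i ∧ m ≤ #(T i) ∧
      δ * #(T i) < |2 * (#(F ∩ T i) : ℝ) - #(T i)| with hG
  have hset : {F : Finset α | ∃ i, F ⊆ S i ∧ T i ⊆ S i ∧ m ≤ #(T i) ∧
      δ * #(T i) < |2 * (#(F ∩ T i) : ℝ) - #(T i)|} =
      (Finset.univ.biUnion G : Finset (Finset α)) := by
    ext F
    simp [hG]
  rw [hset, Set.ncard_coe_finset]
  have hcard : ∀ i, (#(G i) : ℝ) ≤ M * (2 * Real.exp (-(δ ^ 2 * m / 2))) := by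
    intro i
    have hM : 0 ≤ M := le_trans (by positivity) (hS i)
    by_cases h : T i ⊆ S i ∧ m ≤ #(T i)
    · calc (#(G i) : ℝ) ≤
            #((S i).powerset.filter fun F => δ * #(T i) < |2 * (#(F ∩ T i) : ℝ) - #(T i)|) := by
            refine Nat.cast_le.mpr (Finset.card_le_card fun F hF => ?_)
            rw [Finset.mem_filter] at hF ⊢
            exact ⟨hF.1, hF.2.2.2⟩
        _ ≤ 2 ^ #(S i) * (2 * Real.exp (-(δ ^ 2 * #(T i) / 2))) :=
          card_powerset_deviation_le h.1 hδ
        _ ≤ _ := by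
          gcongr
          · exact hS i
          · exact h.2
    · have : G i = ∅ := Finset.filter_eq_empty_iff.mpr fun F _ hF => h ⟨hF.1, hF.2.1⟩
      rw [this, Finset.card_empty, Nat.cast_zero]
      positivity
  calc (#(Finset.univ.biUnion G) : ℝ) ≤ ∑ i, (#(G i) : ℝ) := by
        exact_mod_cast Finset.card_biUnion_le
    _ ≤ ∑ _i : ι, M * (2 * Real.exp (-(δ ^ 2 * m / 2))) := Finset.sum_le_sum fun i _ => hcard i
    _ = _ := by rw [Finset.sum_const, nsmul_eq_mul, Finset.card_univ]

theorem card_filter_mem_eq_card_inter_image {α β : Type*} [DecidableEq α] {s : Finset β}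
    {f : β → α} (hf : Set.InjOn f s) (H : Finset α) :
    #(s.filter fun x => f x ∈ H) = #(H ∩ s.image f) := by
  rw [← Finset.card_image_of_injOn (hf.mono (Finset.filter_subset _ _))]
  congr 1
  ext a
  simp only [Finset.mem_image, Finset.mem_filter, Finset.mem_inter]
  constructor
  · rintro ⟨x, ⟨hx, hH⟩, rfl⟩
    exact ⟨hH, x, hx, rfl⟩
  · rintro ⟨hH, x, hx, rfl⟩
    exact ⟨x, ⟨hx, hH⟩, rfl⟩

/-- The `k`-sets `{a, b} ∪ J` with `a ∈ A` and `b ∈ B`. -/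
def betweenSets {n : ℕ} (J A B : Finset (Fin n)) : Finset (Finset (Fin n)) :=
  (A ×ˢ B).image fun p => insert p.1 (insert p.2 J)

/-- The `k`-sets `p ∪ J` with `p` a pair of elements of `A`. -/
def withinSets {n : ℕ} (J A : Finset (Fin n)) : Finset (Finset (Fin n)) :=
  (A.powersetCard 2).image fun p => p ∪ J

section Links

variable {n k : ℕ} {J A B X Y : Finset (Fin n)}

theorem injOn_insert_insert (hA : Disjoint J A) (hB : Disjoint J B) (hAB : Disjoint A B) :
    Set.InjOn (fun p : Fin n × Fin n => insert p.1 (insert p.2 J)) (A ×ˢ B : Finset _) := by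
  rintro ⟨a, b⟩ hp ⟨c, d⟩ hq h
  change insert a (insert b J) = insert c (insert d J) at h
  simp only [Finset.coe_product, Set.mem_prod, Finset.mem_coe] at hp hq
  rw [Finset.disjoint_left] at hA hB hAB
  have ha : a ∈ insert c (insert d J) := h ▸ Finset.mem_insert_self _ _
  have hb : b ∈ insert c (insert d J) :=
    h ▸ Finset.mem_insert_of_mem (Finset.mem_insert_self _ _)
  simp only [Finset.mem_insert] at ha hb
  grind

theorem injOn_union (hA : Disjoint J A) :
    Set.InjOn (fun p : Finset (Fin n) => p ∪ J) (A.powersetCard 2 : Finset _) := by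
  intro p hp q hq h
  have hp' := (Finset.mem_powersetCard.mp hp).1
  have hq' := (Finset.mem_powersetCard.mp hq).1
  have hpJ : Disjoint p J := (hA.mono_right hp').symm
  have hqJ : Disjoint q J := (hA.mono_right hq').symm
  have h' : p ∪ J = q ∪ J := h
  rw [← Finset.union_sdiff_cancel_right hpJ, h', Finset.union_sdiff_cancel_right hqJ]

theorem card_betweenSets (hA : Disjoint J A) (hB : Disjoint J B) (hAB : Disjoint A B) :
    #(betweenSets J A B) = #A * #B := by
  rw [betweenSets, Finset.card_image_of_injOn (injOn_insert_insert hA hB hAB),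
    Finset.card_product]

theorem card_withinSets (hA : Disjoint J A) : #(withinSets J A) = (#A).choose 2 := by
  rw [withinSets, Finset.card_image_of_injOn (injOn_union hA), Finset.card_powersetCard]

theorem linkBetween_eq (hA : Disjoint J A) (hB : Disjoint J B) (hAB : Disjoint A B)
    (H : Finset (Finset (Fin n))) :
    linkBetween n H J A B = #(H ∩ betweenSets J A B) := by
  rw [betweenSets, ← card_filter_mem_eq_card_inter_image (injOn_insert_insert hA hB hAB) H,
    linkBetween]
  congr 1
  refine Finset.filter_congr fun p hp => ?_
  rw [Finset.mem_product] at hp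
  simp [Finset.disjoint_right.mp hA hp.1, Finset.disjoint_right.mp hB hp.2]

theorem linkWithin_eq (hA : Disjoint J A) (H : Finset (Finset (Fin n))) :
    linkWithin n H J A = #(H ∩ withinSets J A) := by
  rw [withinSets, ← card_filter_mem_eq_card_inter_image (injOn_union hA) H, linkWithin]
  congr 1
  refine Finset.filter_congr fun p hp => ?_
  simp [(hA.mono_right (Finset.mem_powersetCard.mp hp).1).symm]

theorem mem_crossing {e : Finset (Fin n)} :
    e ∈ crossing n k X Y ↔ #e = k ∧ ¬ e ⊆ X ∧ ¬ e ⊆ Y := by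
  simp [crossing, Finset.mem_powersetCard]

theorem crossing_comm : crossing n k X Y = crossing n k Y X := by
  ext e
  rw [mem_crossing, mem_crossing, and_comm (a := ¬ e ⊆ X)]

theorem betweenSets_subset_crossing (hk : 2 ≤ k) (hJ : #J = k - 2) (hXY : Disjoint X Y)
    (hAX : A ⊆ X) (hBY : B ⊆ Y) (hA : Disjoint J A) (hB : Disjoint J B) :
    betweenSets J A B ⊆ crossing n k X Y := by
  intro e he
  obtain ⟨⟨a, b⟩, hp, rfl⟩ := Finset.mem_image.mp he
  obtain ⟨ha, hb⟩ := Finset.mem_product.mp hp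
  have hab : a ≠ b := Finset.disjoint_iff_ne.mp hXY a (hAX ha) b (hBY hb)
  refine mem_crossing.mpr ⟨?_, fun h => ?_, fun h => ?_⟩
  · rw [Finset.card_insert_of_notMem, Finset.card_insert_of_notMem
      (Finset.disjoint_right.mp hB hb), hJ]
    · omega
    · simp [hab, Finset.disjoint_right.mp hA ha]
  · exact Finset.disjoint_left.mp hXY (h (by simp)) (hBY hb)
  · exact Finset.disjoint_left.mp hXY (hAX ha) (h (by simp))

theorem withinSets_subset_crossing (hk : 2 ≤ k) (hJ : #J = k - 2) (hXY : Disjoint X Y)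
    (hAX : A ⊆ X) (hA : Disjoint J A) (hJX : ¬ J ⊆ X) :
    withinSets J A ⊆ crossing n k X Y := by
  intro e he
  obtain ⟨p, hp, rfl⟩ := Finset.mem_image.mp he
  obtain ⟨hpA, hp2⟩ := Finset.mem_powersetCard.mp hp
  refine mem_crossing.mpr ⟨?_, fun h => hJX (Finset.subset_union_right.trans h), fun h => ?_⟩
  · rw [Finset.card_union_of_disjoint (hA.mono_right hpA).symm, hJ, hp2]
    omega
  · obtain ⟨a, ha⟩ : p.Nonempty := Finset.card_pos.mp (by omega)
    exact Finset.disjoint_left.mp hXY (hAX (hpA ha)) (h (Finset.mem_union_left _ ha))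

theorem two_pow_card_crossing_le (hXY : Disjoint X Y) (hu : X ∪ Y = Finset.univ) :
    2 ^ #(crossing n k X Y) ≤ (Bip n k).ncard := by
  rw [← Finset.card_powerset, ← Set.ncard_coe_finset]
  refine Set.ncard_le_ncard (fun H hH => ?_) (Set.toFinite _)
  have hsub : H ⊆ crossing n k X Y := by simpa using hH
  exact ⟨fun e he => (mem_crossing.mp (hsub he)).1, X, Y, hXY, hu,
    fun e he => (mem_crossing.mp (hsub he)).2⟩

end Links

theorem sq_div_four_le_choose_two {s : ℕ} (hs : 2 ≤ s) : (s : ℝ) ^ 2 / 4 ≤ s.choose 2 := by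
  rw [Nat.cast_choose_two]
  have : (2 : ℝ) ≤ s := by exact_mod_cast hs
  nlinarith

theorem lt_abs_two_mul_sub {δ x m : ℝ} (h : ¬ |x - 1 / 2 * m| ≤ δ * (1 / 2 * m)) :
    δ * m < |2 * x - m| := by
  have : |2 * x - m| = 2 * |x - 1 / 2 * m| := by
    rw [← abs_of_pos (zero_lt_two (α := ℝ)), ← abs_mul, abs_of_pos (zero_lt_two (α := ℝ))]
    ring_nf
  rw [this]
  linarith

theorem union_bound_absorbed {δ : ℝ} (hδ0 : 0 < δ) (hδ1 : δ < 1) {n : ℕ}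
    (hn : 128 / δ ^ 4 ≤ (n : ℝ)) :
    3 * (2 : ℝ) ^ (5 * n) * (2 * Real.exp (-(δ ^ 2 * (δ ^ 2 * n ^ 2 / 4) / 2))) ≤
      (2 : ℝ) ^ (-(δ ^ 4 / 16 * (n : ℝ) ^ 2)) := by
  have h4 : 0 < δ ^ 4 := by positivity
  have hn' : 128 ≤ n * δ ^ 4 := (div_le_iff₀ h4).mp hn
  have hδ4 : δ ^ 4 ≤ 1 := pow_le_one₀ hδ0.le hδ1.le
  have hn1 : (1 : ℝ) ≤ n := by nlinarith [Nat.cast_nonneg (α := ℝ) n]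
  have hexp : Real.exp (-(δ ^ 2 * (δ ^ 2 * n ^ 2 / 4) / 2)) ≤
      (2 : ℝ) ^ (-(δ ^ 4 * (n : ℝ) ^ 2 / 8)) := by
    rw [Real.rpow_def_of_pos two_pos, Real.exp_le_exp]
    have hlog : Real.log 2 ≤ 1 := by linarith [Real.log_two_lt_d9]
    have : 0 ≤ δ ^ 4 * (n : ℝ) ^ 2 / 8 := by positivity
    nlinarith
  calc 3 * (2 : ℝ) ^ (5 * n) * (2 * Real.exp (-(δ ^ 2 * (δ ^ 2 * n ^ 2 / 4) / 2)))
      ≤ 3 * (2 : ℝ) ^ (5 * n) * (2 * (2 : ℝ) ^ (-(δ ^ 4 * (n : ℝ) ^ 2 / 8))) := by gcongr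
    _ ≤ (2 : ℝ) ^ 3 * (2 : ℝ) ^ (5 * n) * (2 : ℝ) ^ (-(δ ^ 4 * (n : ℝ) ^ 2 / 8)) := by
      have : 0 < (2 : ℝ) ^ (5 * n) * (2 : ℝ) ^ (-(δ ^ 4 * (n : ℝ) ^ 2 / 8)) := by positivity
      nlinarith
    _ = (2 : ℝ) ^ (3 + 5 * (n : ℝ) + -(δ ^ 4 * (n : ℝ) ^ 2 / 8)) := by
      rw [Real.rpow_add two_pos, Real.rpow_add two_pos]
      norm_cast
    _ ≤ _ := by
      refine Real.rpow_le_rpow_of_exponent_le one_le_two ?_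
      nlinarith

theorem stmt13 (k : ℕ) (hk : 3 ≤ k) (δ : ℝ) (hδ0 : 0 < δ) (hδ1 : δ < 1) :
    ∃ c : ℝ, 0 < c ∧ ∃ N : ℕ, ∀ n : ℕ, N ≤ n →
      (({H ∈ Bip n k | ∃ X Y : Finset (Fin n), IsBipartition n H X Y ∧
          ∃ J X₀ Y₀ : Finset (Fin n), J.card = k - 2 ∧ X₀ ⊆ X ∧ Y₀ ⊆ Y ∧
            Disjoint J X₀ ∧ Disjoint J Y₀ ∧ Disjoint X₀ Y₀ ∧
            δ * n < (X₀.card : ℝ) ∧ δ * n < (Y₀.card : ℝ) ∧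
            ¬ ((|(linkBetween n H J X₀ Y₀ : ℝ) - (1 / 2 : ℝ) * (X₀.card : ℝ) * (Y₀.card : ℝ)|
                  ≤ δ * ((1 / 2 : ℝ) * (X₀.card : ℝ) * (Y₀.card : ℝ))) ∧
               (¬ J ⊆ X → |(linkWithin n H J X₀ : ℝ) - (1 / 2 : ℝ) * (X₀.card.choose 2 : ℝ)|
                  ≤ δ * ((1 / 2 : ℝ) * (X₀.card.choose 2 : ℝ))) ∧
               (¬ J ⊆ Y → |(linkWithin n H J Y₀ : ℝ) - (1 / 2 : ℝ) * (Y₀.card.choose 2 : ℝ)|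
                  ≤ δ * ((1 / 2 : ℝ) * (Y₀.card.choose 2 : ℝ))))}.ncard : ℝ))
        ≤ ((Bip n k).ncard : ℝ) * (2 : ℝ) ^ (-(c * (n : ℝ) ^ 2)) := by
  classical
  refine ⟨δ ^ 4 / 16, by positivity, ⌈128 / δ ^ 4⌉₊, fun n hn => ?_⟩
  have hn' : 128 / δ ^ 4 ≤ (n : ℝ) := Nat.ceil_le.mp hn
  have hδn : 1 ≤ δ * n := by
    have h4 : 0 < δ ^ 4 := by positivity
    have h := (div_le_iff₀ h4).mp hn'
    have hle : δ ^ 4 ≤ δ := pow_le_of_le_one hδ0.le hδ1.le (by norm_num)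
    nlinarith [Nat.cast_nonneg (α := ℝ) n]
  let ι := Fin 3 × Finset (Fin n) × Finset (Fin n) × Finset (Fin n) × Finset (Fin n)
  let S : ι → Finset (Finset (Fin n)) := fun ⟨_, X, _⟩ => crossing n k X Xᶜ
  let T : ι → Finset (Finset (Fin n)) := fun ⟨i, _, J, A, B⟩ =>
    ![betweenSets J A B, withinSets J A, withinSets J B] i
  have hS : ∀ i, (2 : ℝ) ^ #(S i) ≤ ((Bip n k).ncard : ℝ) := fun i => by
    exact_mod_cast two_pow_card_crossing_le disjoint_compl_right (Finset.union_compl i.2.1)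
  have hcount := ncard_exists_deviation_le S T (m := δ ^ 2 * n ^ 2 / 4) hδ0.le hS
  have hι : (Fintype.card ι : ℝ) ≤ 3 * 2 ^ (5 * n) := by
    simp only [ι, Fintype.card_prod, Fintype.card_fin, Fintype.card_finset]
    push_cast
    have : (2 : ℝ) ^ (4 * n) ≤ 2 ^ (5 * n) := pow_le_pow_right₀ one_le_two (by omega)
    have : (2 : ℝ) ^ (4 * n) = 2 ^ n * (2 ^ n * (2 ^ n * 2 ^ n)) := by ring
    linarith
  refine (Nat.cast_le.mpr (Set.ncard_le_ncard ?_ (Set.toFinite _))).trans (hcount.trans ?_)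
  swap
  · calc _ ≤ (3 * 2 ^ (5 * n)) * (((Bip n k).ncard : ℝ) *
          (2 * Real.exp (-(δ ^ 2 * (δ ^ 2 * n ^ 2 / 4) / 2)))) := by gcongr
      _ = ((Bip n k).ncard : ℝ) * (3 * 2 ^ (5 * n) *
          (2 * Real.exp (-(δ ^ 2 * (δ ^ 2 * n ^ 2 / 4) / 2)))) := by ring
      _ ≤ _ := by
        gcongr
        exact union_bound_absorbed hδ0 hδ1 hn'
  rintro H ⟨⟨hH, -⟩, X, Y, ⟨hXY, hu, hcross⟩, J, A, B, hJ, hAX, hBY, hJA, hJB, hAB, hA, hB, hbad⟩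
  have hY : Y = Xᶜ := (IsCompl.of_eq hXY.eq_bot hu).compl_eq.symm
  have hHS : H ⊆ crossing n k X Xᶜ :=
    fun e he => mem_crossing.mpr ⟨hH e he, hY ▸ hcross e he⟩
  have hchoose : ∀ {s : ℕ}, δ * n < (s : ℝ) → δ ^ 2 * n ^ 2 / 4 ≤ (s.choose 2 : ℝ) := by
    intro s hs
    have h2 : 2 ≤ s := by
      have : (1 : ℝ) < s := hδn.trans_lt hs
      exact_mod_cast this
    refine le_trans ?_ (sq_div_four_le_choose_two h2)
    nlinarith
  by_cases h1 : |(linkBetween n H J A B : ℝ) - (1 / 2 : ℝ) * #A * #B| ≤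
      δ * ((1 / 2 : ℝ) * #A * #B)
  · by_cases h2 : ¬ J ⊆ X → |(linkWithin n H J A : ℝ) - (1 / 2 : ℝ) * ((#A).choose 2 : ℝ)| ≤
        δ * ((1 / 2 : ℝ) * ((#A).choose 2 : ℝ))
    · obtain ⟨hJY, h3⟩ := Classical.not_imp.mp fun h3 => hbad ⟨h1, h2, h3⟩
      rw [linkWithin_eq hJB, ← card_withinSets hJB] at h3
      refine ⟨(2, X, J, A, B), hHS, ?_, ?_, lt_abs_two_mul_sub h3⟩
      · change withinSets J B ⊆ crossing n k X Xᶜ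
        rw [← hY, crossing_comm]
        exact withinSets_subset_crossing (by omega) hJ hXY.symm hBY hJB hJY
      · change _ ≤ (#(withinSets J B) : ℝ)
        rw [card_withinSets hJB]
        exact hchoose hB
    · obtain ⟨hJX, h2⟩ := Classical.not_imp.mp h2
      rw [linkWithin_eq hJA, ← card_withinSets hJA] at h2
      refine ⟨(1, X, J, A, B), hHS, ?_, ?_, lt_abs_two_mul_sub h2⟩
      · change withinSets J A ⊆ crossing n k X Xᶜ
        rw [← hY]
        exact withinSets_subset_crossing (by omega) hJ hXY hAX hJA hJX
      · change _ ≤ (#(withinSets J A) : ℝ)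
        rw [card_withinSets hJA]
        exact hchoose hA
  · rw [linkBetween_eq hJA hJB hAB, mul_assoc, ← Nat.cast_mul,
      ← card_betweenSets hJA hJB hAB] at h1
    refine ⟨(0, X, J, A, B), hHS, ?_, ?_, lt_abs_two_mul_sub h1⟩
    · change betweenSets J A B ⊆ crossing n k X Xᶜ
      rw [← hY]
      exact betweenSets_subset_crossing (by omega) hJ hXY hAX hBY hJA hJB
    · change _ ≤ (#(betweenSets J A B) : ℝ)
      rw [card_betweenSets hJA hJB hAB, Nat.cast_mul]
      nlinarith
end

section
/- Fix an integer k ≥ 3, set ε = 40^{−2}·(4k)^{−2k}, let t ≥ 1 be an integer, let 0 < δ ≤ ε/(8t), and let n ≥ 8kt. Let H be a k-graph on [n] with a bipartition [n] = X ∪ Y satisfying |X|, |Y| ≥ (1−δ)n/2. Let J ⊆ X with |J| = k−2; assume that all disjoint sets X₀ ⊆ X \ J and Y₀ ⊆ Y with |X₀|, |Y₀| > δn satisfy e_{H_J}(X₀,Y₀) ≥ (1−δ)·(1/2)·|X₀|·|Y₀|, and that every Y₀ ⊆ Y with |Y₀| > δn satisfies e_{H_J}(Y₀) ≥ (1−δ)·(1/2)·C(|Y₀|,2).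 Let [n] \ J = V₁ ∪ … ∪ V_t be a partition with |V₁| ≤ … ≤ |V_t| ≤ |V₁| + 1, and let C be a graph on [t] with at least C(t,2) − ε·t² edges such that for every edge {i,j} of C the pair (V_i, V_j) is ε-regular in the link graph H_J. Then every ℓ ∈ [t] with deg_C(ℓ) ≥ (1 − 2√ε)·t satisfies: |X ∩ V_ℓ| < ε·|V_ℓ| if and only if e_{H_J}(V_ℓ) ≥ |V_ℓ|²/100. -/
open Finset

/-- Edge density `d_{H_J}(A, B)` of the link graph `H_J` between disjoint `A` and `B`. -/
noncomputable def linkDensity (n : ℕ) (H : Finset (Finset (Fin n)))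
    (J A B : Finset (Fin n)) : ℝ :=
  (linkBetween n H J A B : ℝ) / ((A.card : ℝ) * (B.card : ℝ))

/-- `(A, B)` is an `ε`-regular pair in the link graph `H_J`. -/
def IsRegularPair (n : ℕ) (H : Finset (Finset (Fin n))) (J : Finset (Fin n)) (ε : ℝ)
    (A B : Finset (Fin n)) : Prop :=
  ∀ A' ⊆ A, ∀ B' ⊆ B, ε * (A.card : ℝ) < (A'.card : ℝ) → ε * (B.card : ℝ) < (B'.card : ℝ) →
    |linkDensity n H J A' B' - linkDensity n H J A B| < ε

lemma linkWithin_mono {n : ℕ} (H : Finset (Finset (Fin n))) (J : Finset (Fin n))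
    {A B : Finset (Fin n)} (h : A ⊆ B) : linkWithin n H J A ≤ linkWithin n H J B :=
  card_le_card (filter_subset_filter _ (powersetCard_mono h))

lemma linkBetween_eq_sum_singleton {n : ℕ} (H : Finset (Finset (Fin n)))
    (J A B : Finset (Fin n)) :
    linkBetween n H J A B = ∑ y ∈ B, linkBetween n H J A {y} := by
  simp only [linkBetween, card_filter, sum_product_right, sum_singleton]

lemma linkBetween_insert_le {n : ℕ} (H : Finset (Finset (Fin n))) (J A B : Finset (Fin n))
    (y : Fin n) :
    linkBetween n H J A (insert y B) ≤ linkBetween n H J A {y} + linkBetween n H J A B := by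
  rw [linkBetween_eq_sum_singleton H J A (insert y B), linkBetween_eq_sum_singleton H J A B]
  by_cases hy : y ∈ B
  · rw [insert_eq_self.2 hy]
    exact Nat.le_add_left _ _
  · rw [sum_insert hy]

lemma linkBetween_eq_zero {n : ℕ} {H : Finset (Finset (Fin n))} {X Y J A B : Finset (Fin n)}
    (hbip : IsBipartition n H X Y) (hJ : J ⊆ X) (hA : A ⊆ X) (hB : B ⊆ X) :
    linkBetween n H J A B = 0 := by
  rw [linkBetween, card_eq_zero, filter_eq_empty_iff]
  rintro ⟨a, b⟩ hab ⟨-, -, he⟩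
  rw [mem_product] at hab
  exact (hbip.2.2 _ he).1 (insert_subset (hA hab.1) (insert_subset (hB hab.2) hJ))

/-- Every link edge inside `A` meets `Y` when the index set of the link lies in `X`. -/
lemma linkWithin_le_mul {n : ℕ} {H : Finset (Finset (Fin n))} {X Y J : Finset (Fin n)}
    (hbip : IsBipartition n H X Y) (hJ : J ⊆ X) (A : Finset (Fin n)) :
    linkWithin n H J A ≤ (Y ∩ A).card * A.card := by
  rw [← card_product]
  refine (card_le_card ?_).trans
    (card_image_le (s := (Y ∩ A) ×ˢ A) (f := fun p => ({p.1, p.2} : Finset (Fin n))))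
  intro e he
  rw [mem_filter, mem_powersetCard] at he
  obtain ⟨⟨heA, hcard⟩, -, heH⟩ := he
  obtain ⟨a, b, -, rfl⟩ := card_eq_two.1 hcard
  have haA : a ∈ A := heA (by simp)
  have hbA : b ∈ A := heA (by simp)
  have hXY : ∀ v, v ∉ Y → v ∈ X := fun v hv =>
    (mem_union.1 (hbip.2.1 ▸ mem_univ v)).resolve_right hv
  rw [mem_image]
  by_cases ha : a ∈ Y
  · exact ⟨(a, b), by simp [ha, haA, hbA], rfl⟩
  by_cases hb : b ∈ Y
  · exact ⟨(b, a), by simp [hb, haA, hbA], pair_comm _ _⟩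
  · refine absurd (union_subset ?_ hJ) (hbip.2.2 _ heH).1
    exact insert_subset (hXY a ha) (singleton_subset_iff.2 (hXY b hb))

lemma card_inter_add_card_inter {n : ℕ} {H : Finset (Finset (Fin n))} {X Y : Finset (Fin n)}
    (hbip : IsBipartition n H X Y) (A : Finset (Fin n)) :
    (X ∩ A).card + (Y ∩ A).card = A.card := by
  rw [← card_union_of_disjoint (hbip.1.mono inter_subset_left inter_subset_left),
    ← union_inter_distrib_right, hbip.2.1, univ_inter]

/-- The degree of a vertex in a family of pairs is at most its number of neighbours. -/
lemma card_filter_mem_le_neighbors {α : Type*} [Fintype α] [DecidableEq α]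
    {C : Finset (Finset α)} (hC : ∀ e ∈ C, e.card = 2) (v : α) :
    (C.filter fun e => v ∈ e).card ≤ (univ.filter fun i => ({v, i} : Finset α) ∈ C).card := by
  refine (card_le_card ?_).trans (card_image_le (f := fun i => ({v, i} : Finset α)))
  intro e he
  rw [mem_filter] at he
  obtain ⟨a, b, -, rfl⟩ := card_eq_two.1 (hC e he.1)
  rw [mem_image]
  have hv := he.2
  rw [mem_insert, mem_singleton] at hv
  rcases hv with rfl | rfl
  · exact ⟨b, by simpa using he.1, rfl⟩
  · exact ⟨a, by simpa [pair_comm] using he.1, pair_comm _ _⟩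

/-- In a regular pair `(A, B)`, if a large `A' ⊆ A` has no link edges to a nonempty `B₀ ⊆ B` with
at least `ε |B|` vertices, then `A'` has density less than `4 ε` to every large `B' ⊆ B` disjoint
from `B₀`. -/
lemma IsRegularPair.linkDensity_lt {n : ℕ} {H : Finset (Finset (Fin n))}
    {J A B A' B' B₀ : Finset (Fin n)} {ε : ℝ} (hreg : IsRegularPair n H J ε A B)
    (hA' : A' ⊆ A) (hB' : B' ⊆ B) (hB₀ : B₀ ⊆ B) (hdisj : Disjoint B₀ B')
    (hA'card : ε * A.card < A'.card) (hB'card : ε * B.card < B'.card)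
    (hB₀card : ε * B.card ≤ B₀.card) (hne : B₀.Nonempty) (hne' : B'.Nonempty)
    (hzero : linkBetween n H J A' B₀ = 0) :
    linkDensity n H J A' B' < 4 * ε := by
  obtain ⟨y, hy, hmin⟩ : ∃ y ∈ B', (linkBetween n H J A' {y} : ℝ) * B'.card ≤
      linkBetween n H J A' B' := by
    by_contra! h
    have hlt := sum_lt_sum_of_nonempty hne' h
    rw [← sum_mul, sum_const, nsmul_eq_mul, ← Nat.cast_sum,
      ← linkBetween_eq_sum_singleton, mul_comm] at hlt
    exact lt_irrefl _ hlt
  have hyB₀ : y ∉ B₀ := fun h => disjoint_left.1 hdisj h hy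
  have hcard : ((insert y B₀).card : ℝ) = B₀.card + 1 := by
    rw [card_insert_of_notMem hyB₀, Nat.cast_succ]
  have hreg₁ := abs_lt.1 (hreg A' hA' B' hB' hA'card hB'card)
  have hreg₂ := abs_lt.1 (hreg A' hA' (insert y B₀) (insert_subset (hB' hy) hB₀) hA'card
    (by rw [hcard]; linarith))
  have hle : (linkBetween n H J A' (insert y B₀) : ℝ) ≤ linkBetween n H J A' {y} := by
    have := linkBetween_insert_le H J A' B₀ y
    rw [hzero] at this
    exact_mod_cast this
  have hB'pos : (0 : ℝ) < B'.card := by exact_mod_cast hne'.card_pos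
  have hB₀pos : (1 : ℝ) ≤ B₀.card := by exact_mod_cast hne.card_pos
  have hhalf : linkDensity n H J A' (insert y B₀) ≤ linkDensity n H J A' B' / 2 := by
    rcases (A'.card).eq_zero_or_pos with h0 | hpos
    · simp [linkDensity, h0]
    have hApos : (0 : ℝ) < A'.card := by exact_mod_cast hpos
    rw [linkDensity, linkDensity, hcard, div_div, div_le_div_iff₀ (by positivity) (by positivity)]
    have h1 : (linkBetween n H J A' (insert y B₀) : ℝ) * B'.card * 2 ≤
        linkBetween n H J A' B' * (B₀.card + 1) := by
      have h2 : (linkBetween n H J A' (insert y B₀) : ℝ) * B'.card ≤ linkBetween n H J A' B' :=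
        (mul_le_mul_of_nonneg_right hle hB'pos.le).trans hmin
      have h3 : (0 : ℝ) ≤ linkBetween n H J A' B' := Nat.cast_nonneg _
      nlinarith
    nlinarith [mul_le_mul_of_nonneg_left h1 hApos.le]
  linarith [hreg₁.1, hreg₁.2, hreg₂.1, hreg₂.2]

theorem stmt18 (k : ℕ) (hk : 3 ≤ k) (ε : ℝ)
    (hε : ε = 1 / ((40 : ℝ) ^ 2 * (4 * (k : ℝ)) ^ (2 * k)))
    (t : ℕ) (ht : 1 ≤ t) (δ : ℝ) (hδ0 : 0 < δ) (hδ1 : δ ≤ ε / (8 * t))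
    (n : ℕ) (hn : 8 * k * t ≤ n)
    (H : Finset (Finset (Fin n))) (hH : IsKGraph n k H)
    (X Y : Finset (Fin n)) (hbip : IsBipartition n H X Y)
    (hX : (1 - δ) * n / 2 ≤ (X.card : ℝ)) (hY : (1 - δ) * n / 2 ≤ (Y.card : ℝ))
    (J : Finset (Fin n)) (hJX : J ⊆ X) (hJ : J.card = k - 2)
    (hdense : ∀ X₀ Y₀ : Finset (Fin n), X₀ ⊆ X \ J → Y₀ ⊆ Y → Disjoint X₀ Y₀ →
      δ * n < (X₀.card : ℝ) → δ * n < (Y₀.card : ℝ) →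
      (1 - δ) * ((1 / 2 : ℝ) * (X₀.card : ℝ) * (Y₀.card : ℝ)) ≤ (linkBetween n H J X₀ Y₀ : ℝ))
    (hdenseY : ∀ Y₀ : Finset (Fin n), Y₀ ⊆ Y → δ * n < (Y₀.card : ℝ) →
      (1 - δ) * ((1 / 2 : ℝ) * (Y₀.card.choose 2 : ℝ)) ≤ (linkWithin n H J Y₀ : ℝ))
    (V : Fin t → Finset (Fin n))
    (hVdisj : ∀ i j : Fin t, i ≠ j → Disjoint (V i) (V j))
    (hVcover : Finset.univ.biUnion V = Finset.univ \ J)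
    (hVmono : ∀ i j : Fin t, i ≤ j → (V i).card ≤ (V j).card)
    (hVequit : ∀ i j : Fin t, (V i).card ≤ (V j).card + 1)
    (C : Finset (Finset (Fin t))) (hC2 : ∀ e ∈ C, e.card = 2)
    (hCcard : (t.choose 2 : ℝ) - ε * (t : ℝ) ^ 2 ≤ (C.card : ℝ))
    (hCreg : ∀ i j : Fin t, ({i, j} : Finset (Fin t)) ∈ C →
      IsRegularPair n H J ε (V i) (V j)) :
    ∀ ℓ : Fin t, (1 - 2 * Real.sqrt ε) * t ≤ ((C.filter fun e => ℓ ∈ e).card : ℝ) →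
      (((X ∩ V ℓ).card : ℝ) < ε * ((V ℓ).card : ℝ) ↔
        ((V ℓ).card : ℝ) ^ 2 / 100 ≤ (linkWithin n H J (V ℓ) : ℝ)) := by
  intro ℓ hℓ
  have hkR : (3 : ℝ) ≤ k := by exact_mod_cast hk
  have htR : (1 : ℝ) ≤ t := by exact_mod_cast ht
  have hnR : 8 * (k : ℝ) * t ≤ n := by exact_mod_cast hn
  have hkt : (k : ℝ) ≤ k * t := le_mul_of_one_le_right (by linarith) htR
  have htk : 3 * (t : ℝ) ≤ k * t := mul_le_mul_of_nonneg_right hkR (by linarith)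
  have hn0 : (0 : ℝ) < n := by linarith
  have hP : (1 : ℝ) ≤ (4 * (k : ℝ)) ^ (2 * k) := one_le_pow₀ (by linarith)
  have hε0 : 0 < ε := by rw [hε]; positivity
  have hε1 : ε ≤ (1 / 40) ^ 2 := by
    rw [hε, div_pow, one_pow]
    exact one_div_le_one_div_of_le (by positivity) (le_mul_of_one_le_right (by positivity) hP)
  have hsqrt : Real.sqrt ε ≤ 1 / 40 := Real.sqrt_le_iff.2 ⟨by norm_num, hε1⟩
  have hδt : δ * (8 * t) ≤ ε := (le_div_iff₀ (by positivity)).1 hδ1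
  have hδε : δ ≤ ε := (le_mul_of_one_le_right hδ0.le (by linarith)).trans hδt
  have hsum : ∑ i, (V i).card + k = n + 2 := by
    have h := congrArg card hVcover
    rw [card_biUnion fun i _ j _ hij => hVdisj i j hij, card_sdiff_of_subset (subset_univ _),
      card_univ, Fintype.card_fin, hJ] at h
    have h8 : k ≤ n := by
      have : (k : ℝ) ≤ n := by linarith
      exact_mod_cast this
    omega
  have hsumR : ∑ i, ((V i).card : ℝ) + k = n + 2 := by exact_mod_cast hsum
  have hlow : ∀ i, (n : ℝ) ≤ 2 * (t * (V i).card) := fun i => by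
    have h : ∑ j, ((V j).card : ℝ) ≤ ∑ _j : Fin t, (((V i).card : ℝ) + 1) :=
      sum_le_sum fun j _ => by exact_mod_cast hVequit j i
    rw [sum_const, card_univ, Fintype.card_fin, nsmul_eq_mul] at h
    linarith
  have hup : ∀ i, (t : ℝ) * (V i).card ≤ n + t := fun i => by
    have h : ∑ _j : Fin t, ((V i).card : ℝ) ≤ ∑ j, (((V j).card : ℝ) + 1) :=
      sum_le_sum fun j _ => by exact_mod_cast hVequit i j
    rw [sum_add_distrib, sum_const, sum_const, card_univ, Fintype.card_fin, nsmul_eq_mul,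
      nsmul_eq_mul, mul_one] at h
    linarith
  have hδn : ∀ i, δ * n ≤ ε * (V i).card := fun i => by
    have h1 := mul_le_mul_of_nonneg_left (hlow i) hδ0.le
    have h2 := mul_le_mul_of_nonneg_right hδt (Nat.cast_nonneg (α := ℝ) (V i).card)
    have h3 : 0 ≤ δ * (t * ((V i).card : ℝ)) := by positivity
    linarith
  have hm : (12 : ℝ) ≤ (V ℓ).card := by
    have : (t : ℝ) * 12 ≤ t * (V ℓ).card := by linarith [hlow ℓ]
    exact le_of_mul_le_mul_left this (by linarith)
  have hsplit : ((X ∩ V ℓ).card : ℝ) + (Y ∩ V ℓ).card = (V ℓ).card := by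
    exact_mod_cast card_inter_add_card_inter hbip (V ℓ)
  have hεm : ε * (V ℓ).card ≤ (1 / 40) ^ 2 * (V ℓ).card :=
    mul_le_mul_of_nonneg_right hε1 (by linarith)
  constructor
  · intro hXℓ
    have hy : (9 / 10 : ℝ) * (V ℓ).card ≤ (Y ∩ V ℓ).card := by linarith
    have h := hdenseY (Y ∩ V ℓ) inter_subset_left (by linarith [hδn ℓ])
    have hmono : (linkWithin n H J (Y ∩ V ℓ) : ℝ) ≤ linkWithin n H J (V ℓ) := by
      exact_mod_cast linkWithin_mono H J inter_subset_right
    rw [Nat.cast_choose_two] at h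
    have hyy : (V ℓ).card * ((V ℓ).card : ℝ) / 2 ≤
        ((Y ∩ V ℓ).card : ℝ) * ((Y ∩ V ℓ).card - 1) := by
      have h1 : (8 / 10 : ℝ) * (V ℓ).card ≤ (Y ∩ V ℓ).card - 1 := by linarith
      have h2 := mul_le_mul hy h1 (by positivity) (by positivity)
      have h3 := mul_self_nonneg ((V ℓ).card : ℝ)
      linarith
    have hδ : (9 / 10 : ℝ) ≤ 1 - δ := by linarith
    have h4 := mul_le_mul hδ hyy (by positivity) (by linarith)
    have h5 := mul_self_nonneg ((V ℓ).card : ℝ)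
    rw [pow_two]
    linarith
  · intro hedges
    by_contra! hXℓ
    have hYℓ : ε * (V ℓ).card < (Y ∩ V ℓ).card := by
      by_contra! hY'
      have h : (linkWithin n H J (V ℓ) : ℝ) ≤ (Y ∩ V ℓ).card * (V ℓ).card := by
        exact_mod_cast linkWithin_le_mul hbip hJX (V ℓ)
      have h' := mul_le_mul_of_nonneg_right (hY'.trans hεm) (by linarith : 0 ≤ ((V ℓ).card : ℝ))
      have hpos : 0 < ((V ℓ).card : ℝ) * (V ℓ).card := by positivity
      rw [pow_two] at hedges
      linarith
    obtain ⟨i, hi, hXi⟩ : ∃ i, ({ℓ, i} : Finset (Fin t)) ∈ C ∧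
        ε * (V i).card < (X ∩ V i).card := by
      by_contra! hno
      set N := univ.filter fun i => ({ℓ, i} : Finset (Fin t)) ∈ C
      have hNcard : (1 - 2 * Real.sqrt ε) * t ≤ N.card :=
        hℓ.trans (by exact_mod_cast card_filter_mem_le_neighbors hC2 ℓ)
      have hXle : (X.card : ℝ) ≤ (J.card : ℝ) + ∑ i, ((X ∩ V i).card : ℝ) := by
        have hsub : X ⊆ J ∪ univ.biUnion fun i => X ∩ V i := by
          rw [← inter_biUnion, hVcover]
          intro x hx
          by_cases hxJ : x ∈ J <;> simp [hx, hxJ]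
        exact_mod_cast (card_le_card hsub).trans
          ((card_union_le _ _).trans (Nat.add_le_add_left card_biUnion_le _))
      have hJk : (J.card : ℝ) ≤ k := by
        rw [hJ]
        exact_mod_cast Nat.sub_le k 2
      have hpart : ∑ i, ((X ∩ V i).card : ℝ) =
          ∑ i ∈ N, ((X ∩ V i).card : ℝ) + ∑ i ∈ Nᶜ, ((X ∩ V i).card : ℝ) :=
        (sum_add_sum_compl N _).symm
      have hNsum : ∑ i ∈ N, ((X ∩ V i).card : ℝ) ≤ ε * (n + 2) :=
        calc ∑ i ∈ N, ((X ∩ V i).card : ℝ)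
            ≤ ∑ i ∈ N, ε * ((V i).card : ℝ) :=
              sum_le_sum fun i hi => hno i (mem_filter.1 hi).2
          _ ≤ ∑ i, ε * ((V i).card : ℝ) :=
              sum_le_sum_of_subset_of_nonneg (subset_univ _) fun i _ _ => by positivity
          _ ≤ ε * (n + 2) := by
              rw [← mul_sum]
              exact mul_le_mul_of_nonneg_left (by linarith) hε0.le
      have hNc : (Nᶜ.card : ℝ) ≤ t / 20 := by
        rw [card_compl, Fintype.card_fin, Nat.cast_sub (by simpa using card_le_univ N)]
        have := mul_le_mul_of_nonneg_right hsqrt (by linarith : (0 : ℝ) ≤ t)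
        linarith
      have hNcsum : ∑ i ∈ Nᶜ, ((X ∩ V i).card : ℝ) ≤ Nᶜ.card * ((n + t) / t) := by
        rw [← nsmul_eq_mul]
        refine sum_le_card_nsmul _ _ _ fun i _ => ?_
        refine le_trans (Nat.cast_le.2 (card_le_card inter_subset_right)) ?_
        rw [le_div_iff₀ (by linarith), mul_comm]
        exact hup i
      have hNcsum' : (Nᶜ.card : ℝ) * ((n + t) / t) ≤ (n + t) / 20 := by
        calc (Nᶜ.card : ℝ) * ((n + t) / t) ≤ t / 20 * ((n + t) / t) :=
              mul_le_mul_of_nonneg_right hNc (by positivity)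
          _ = (n + t) / 20 := by field_simp
      have hεn : ε * (n + 2) ≤ (1 / 40) ^ 2 * (n + 2) :=
        mul_le_mul_of_nonneg_right hε1 (by linarith)
      have hδn' : δ * n ≤ (1 / 40) ^ 2 * n :=
        mul_le_mul_of_nonneg_right (hδε.trans hε1) hn0.le
      linarith
    have hiℓ : ({i, ℓ} : Finset (Fin t)) ∈ C := pair_comm ℓ i ▸ hi
    have hXipos : (0 : ℝ) < (X ∩ V i).card := (by positivity : 0 ≤ ε * _).trans_lt hXi
    have hYℓpos : (0 : ℝ) < (Y ∩ V ℓ).card := (by positivity : 0 ≤ ε * _).trans_lt hYℓ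
    have hXℓpos : (0 : ℝ) < (X ∩ V ℓ).card := lt_of_lt_of_le (by positivity) hXℓ
    have hsmall := (hCreg i ℓ hiℓ).linkDensity_lt (A' := X ∩ V i) (B' := Y ∩ V ℓ)
      (B₀ := X ∩ V ℓ) inter_subset_right inter_subset_right inter_subset_right
      (hbip.1.mono inter_subset_left inter_subset_left) hXi hYℓ hXℓ
      (card_pos.1 (by exact_mod_cast hXℓpos)) (card_pos.1 (by exact_mod_cast hYℓpos))
      (linkBetween_eq_zero hbip hJX inter_subset_left inter_subset_left)
    have hViJ : V i ⊆ univ \ J := hVcover ▸ subset_biUnion_of_mem V (mem_univ i)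
    have hbig := hdense (X ∩ V i) (Y ∩ V ℓ)
      (fun x hx => mem_sdiff.2 ⟨(mem_inter.1 hx).1, (mem_sdiff.1 (hViJ (mem_inter.1 hx).2)).2⟩)
      inter_subset_left (hbip.1.mono inter_subset_left inter_subset_left)
      ((hδn i).trans_lt hXi) ((hδn ℓ).trans_lt hYℓ)
    rw [linkDensity, div_lt_iff₀ (by positivity)] at hsmall
    have hlt : 4 * ε < (1 - δ) * (1 / 2) := by linarith
    have := mul_lt_mul_of_pos_right hlt (mul_pos hXipos hYℓpos)
    linarith
end
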